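/- Let M ≥ 1 and Kc ≥ 0 be integers, λ > 0, y ∈ ℝ × ℂ^{Kc}, and let E(y,·) be an admissible data-fidelity functional. Then the functional J(w,a) := E(y, ν(w,a)) + λ‖w‖_M, over pairs (w,a) with w ∈ M(𝕋) of zero mean and a ∈ ℝ, admits a unique minimizer (w*, a*). Moreover, there exist an integer N with 0 ≤ N ≤ 2·Kc, pairwise distinct points x₁, …, x_N ∈ 𝕋, and nonzero reals a₁, …, a_N with a₁ + ⋯ + a_N = 0 such that w* = Σₙ aₙ δ_{xₙ} (a finite combination of Dirac measures). Equivalently, the TV-regularized recovery of a periodic function from its first Kc+1 Fourier coefficients with regularization ‖D^M f‖_M has a unique solution, which is a periodic D^M-spline with at most 2·Kc knots. -/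

import Mathlib

open MeasureTheory Filter
open scoped ENNReal Real

noncomputable section

instance fact2pi : Fact (0 < 2 * Real.pi) := ⟨by positivity⟩

/-- The circle `𝕋 = ℝ/(2πℤ)`. -/
abbrev Circle2pi : Type := AddCircle (2 * Real.pi)

/-- Integral of a real function against a finite real signed (Radon) measure on `𝕋`. -/
noncomputable def sIntR (w : SignedMeasure Circle2pi) (f : Circle2pi → ℝ) : ℝ :=
  (∫ x, f x ∂w.toJordanDecomposition.posPart) - ∫ x, f x ∂w.toJordanDecomposition.negPart

/-- Integral of a complex function against a signed measure on `𝕋`. -/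
noncomputable def sIntC (w : SignedMeasure Circle2pi) (f : Circle2pi → ℂ) : ℂ :=
  (∫ x, f x ∂w.toJordanDecomposition.posPart) - ∫ x, f x ∂w.toJordanDecomposition.negPart

/-- Total-variation norm `‖w‖_M` of a signed measure on `𝕋`. -/
noncomputable def tvNorm (w : SignedMeasure Circle2pi) : ℝ :=
  (w.totalVariation Set.univ).toReal

/-- The `k`-th Fourier coefficient `ŵ[k] = ∫_𝕋 e^{-ikx} dw(x)` of a signed measure. -/
noncomputable def fCoeff (w : SignedMeasure Circle2pi) (k : ℤ) : ℂ :=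
  sIntC w fun x => fourier (-k) x

/-- The Dirac measure `δ_x` as a signed measure. -/
noncomputable def diracSM (x : Circle2pi) : SignedMeasure Circle2pi :=
  (MeasureTheory.Measure.dirac x).toSignedMeasure

/-- The measurement map `ν(w,a) = (a, ŵ[1]/(i·1)^M, …, ŵ[Kc]/(i·Kc)^M)`. -/
noncomputable def nuMap (M Kc : ℕ) (w : SignedMeasure Circle2pi) (a : ℝ) :
    ℝ × (Fin Kc → ℂ) :=
  (a, fun k => fCoeff w ((k.1 : ℤ) + 1) / (Complex.I * ((k.1 + 1 : ℕ) : ℂ)) ^ M)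

/-- Admissibility of a data-fidelity functional `E(y,·) : ℝ × ℂ^{Kc} → [0,∞]`:
proper, convex, strictly convex on its effective domain, lower semicontinuous, coercive. -/
structure Admissible {Kc : ℕ} (E : ℝ × (Fin Kc → ℂ) → ℝ≥0∞) : Prop where
  proper : ∃ z, E z ≠ ∞
  convex : ∀ z z' : ℝ × (Fin Kc → ℂ), ∀ t : ℝ, 0 ≤ t → t ≤ 1 →
    E (t • z + (1 - t) • z') ≤ ENNReal.ofReal t * E z + ENNReal.ofReal (1 - t) * E z'
  strictConvexOnDom : ∀ z z' : ℝ × (Fin Kc → ℂ), E z ≠ ∞ → E z' ≠ ∞ → z ≠ z' →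
    ∀ t : ℝ, 0 < t → t < 1 →
      E (t • z + (1 - t) • z') < ENNReal.ofReal t * E z + ENNReal.ofReal (1 - t) * E z'
  lsc : LowerSemicontinuous E
  coercive : Tendsto E (Filter.comap norm Filter.atTop) (nhds ∞)

/-- The penalized objective `J(w,a) = E(ν(w,a)) + λ‖w‖_M` (with values in `[0,∞]`). -/
noncomputable def penJ {Kc : ℕ} (M : ℕ) (E : ℝ × (Fin Kc → ℂ) → ℝ≥0∞) (lam : ℝ)
    (w : SignedMeasure Circle2pi) (a : ℝ) : ℝ≥0∞ :=
  E (nuMap M Kc w a) + ENNReal.ofReal (lam * tvNorm w)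

end


/-! ## Compactness of convex hulls -/
theorem aux_convexHull_compact {V : Type*} [NormedAddCommGroup V] [NormedSpace ℝ V]
    [FiniteDimensional ℝ V] {s : Set V} (hs : IsCompact s) : IsCompact (convexHull ℝ s) := by
  classical
  set d := Module.finrank ℝ V with hd
  let g : (Fin (d+1) → ℝ) × (Fin (d+1) → V) → V := fun p => ∑ i, p.1 i • p.2 i
  have hg : Continuous g := by fun_prop
  have hc : IsCompact (stdSimplex ℝ (Fin (d+1)) ×ˢ (Set.univ.pi fun _ : Fin (d+1) => s)) :=
    (isCompact_stdSimplex ℝ (Fin (d+1))).prod (isCompact_univ_pi fun _ => hs)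
  have : convexHull ℝ s =
      g '' (stdSimplex ℝ (Fin (d+1)) ×ˢ (Set.univ.pi fun _ : Fin (d+1) => s)) := by
    apply Set.Subset.antisymm
    · intro x hx
      rw [convexHull_eq_union] at hx
      simp only [Set.mem_iUnion] at hx
      obtain ⟨t, hts, hind, hxt⟩ := hx
      have hcard : t.card ≤ d + 1 := by
        have := hind.card_le_finrank_succ
        rw [Fintype.card_coe] at this
        refine this.trans ?_
        have := Submodule.finrank_le (vectorSpan ℝ (Set.range ((↑) : t → V)))
        omega
      have hne : t.Nonempty := by
        rcases t.eq_empty_or_nonempty with h | h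
        · subst h; simp at hxt
        · exact h
      obtain ⟨f, hf⟩ : ∃ f : Fin (d+1) → t, Function.Surjective f := by
        have : Nonempty t := hne.to_subtype
        obtain ⟨e⟩ : Nonempty (t ↪ Fin (d+1)) := by
          apply Function.Embedding.nonempty_of_card_le
          simpa using hcard
        exact ⟨Function.invFun e, Function.invFun_surjective e.injective⟩
      have hr : (t : Set V) = Set.range (fun i => (f i : V)) := by
        ext y; constructor
        · intro hy
          obtain ⟨i, hi⟩ := hf ⟨y, hy⟩
          exact ⟨i, by simp [hi]⟩
        · rintro ⟨i, rfl⟩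
          exact (f i).2
      rw [hr] at hxt
      have h2 : Set.range (fun i => (f i : V)) =
          (Fintype.linearCombination ℝ (fun i => (f i : V))) ''
            (Set.range fun i j : Fin (d+1) => if i = j then (1:ℝ) else 0) := by
        rw [← Set.range_comp]
        congr 1
        ext i
        simp [Fintype.linearCombination_apply]
      rw [h2, ← LinearMap.image_convexHull, convexHull_basis_eq_stdSimplex] at hxt
      obtain ⟨c, hc, rfl⟩ := hxt
      refine ⟨(c, fun i => (f i : V)), ⟨hc, fun i _ => hts (f i).2⟩, ?_⟩
      simp [g, Fintype.linearCombination_apply]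
    · rintro _ ⟨⟨c, v⟩, ⟨hc, hv⟩, rfl⟩
      refine (convex_convexHull ℝ s).sum_mem (fun i _ => hc.1 i) hc.2 ?_
      intro i _
      exact subset_convexHull ℝ s (hv i (Set.mem_univ _))
  rw [this]
  exact hc.image hg

/-! ## Signed measures -/

theorem tv_add (w v : SignedMeasure Circle2pi) : tvNorm (w + v) ≤ tvNorm w + tvNorm v := by
  unfold tvNorm
  have hw : w.totalVariation Set.univ ≠ ∞ := by
    unfold SignedMeasure.totalVariation; exact measure_ne_top _ _
  have hv : v.totalVariation Set.univ ≠ ∞ := by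
    unfold SignedMeasure.totalVariation; exact measure_ne_top _ _
  rw [← ENNReal.toReal_add hw hv]
  apply ENNReal.toReal_mono (by simp [hw, hv])
  rw [SignedMeasure.totalVariation_eq_variation, SignedMeasure.totalVariation_eq_variation,
    SignedMeasure.totalVariation_eq_variation]
  exact VectorMeasure.variation_add_le Set.univ

theorem tv_smul (c : ℝ) (w : SignedMeasure Circle2pi) : tvNorm (c • w) = |c| * tvNorm w := by
  unfold tvNorm
  rw [SignedMeasure.totalVariation_eq_variation, SignedMeasure.totalVariation_eq_variation,
    VectorMeasure.variation_smul]
  rw [Measure.smul_apply, ENNReal.smul_def, smul_eq_mul, ENNReal.toReal_mul]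
  simp

theorem tv_nonneg (w : SignedMeasure Circle2pi) : 0 ≤ tvNorm w := ENNReal.toReal_nonneg

theorem tv_eq (w : SignedMeasure Circle2pi) : tvNorm w =
    w.toJordanDecomposition.posPart.real Set.univ +
      w.toJordanDecomposition.negPart.real Set.univ := by
  unfold tvNorm SignedMeasure.totalVariation
  rw [Measure.add_apply, ENNReal.toReal_add (measure_ne_top _ _) (measure_ne_top _ _)]
  rfl

theorem tv_dirac (x : Circle2pi) : tvNorm (diracSM x) = 1 := by
  unfold tvNorm diracSM
  rw [SignedMeasure.totalVariation_eq_variation, Measure.variation_toSignedMeasure]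
  simp

theorem sm_eq (w : SignedMeasure Circle2pi) : w =
    w.toJordanDecomposition.posPart.toSignedMeasure -
      w.toJordanDecomposition.negPart.toSignedMeasure :=
  (SignedMeasure.toSignedMeasure_toJordanDecomposition w).symm

theorem tv_eq_zero {w : SignedMeasure Circle2pi} (h : tvNorm w = 0) : w = 0 := by
  rw [tv_eq] at h
  have h1 : w.toJordanDecomposition.posPart.real Set.univ = 0 := by
    linarith [measureReal_nonneg (μ := w.toJordanDecomposition.posPart) (s := Set.univ),
      measureReal_nonneg (μ := w.toJordanDecomposition.negPart) (s := Set.univ)]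
  have h2 : w.toJordanDecomposition.negPart.real Set.univ = 0 := by linarith
  rw [measureReal_eq_zero_iff, Measure.measure_univ_eq_zero] at h1 h2
  rw [sm_eq w]
  ext s hs
  rw [Measure.toSignedMeasure_sub_apply hs, h1, h2]
  simp

section
variable {V : Type*} [NormedAddCommGroup V] [NormedSpace ℝ V]

/-- Integral of a continuous vector-valued function. -/
noncomputable def sInt (w : SignedMeasure Circle2pi) (f : Circle2pi → V) : V :=
  (∫ x, f x ∂w.toJordanDecomposition.posPart) - ∫ x, f x ∂w.toJordanDecomposition.negPart

theorem cont_int {f : Circle2pi → V} (hf : Continuous f) (μ : Measure Circle2pi)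
    [IsFiniteMeasure μ] : Integrable f μ :=
  hf.integrable_of_hasCompactSupport (HasCompactSupport.of_compactSpace f)

theorem sInt_of_sub {f : Circle2pi → V} (hf : Continuous f) (w : SignedMeasure Circle2pi)
    (μ ν : Measure Circle2pi) [IsFiniteMeasure μ] [IsFiniteMeasure ν]
    (h : w = μ.toSignedMeasure - ν.toSignedMeasure) :
    sInt w f = (∫ x, f x ∂μ) - ∫ x, f x ∂ν := by
  have h0 := sm_eq w
  unfold sInt
  generalize w.toJordanDecomposition = j at *
  have h1 : (j.posPart + ν) = (μ + j.negPart) := by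
    rw [← Measure.toSignedMeasure_eq_toSignedMeasure_iff, Measure.toSignedMeasure_add,
      Measure.toSignedMeasure_add]
    rw [h] at h0
    rw [← sub_eq_sub_iff_add_eq_add]
    exact h0.symm
  have h2 : ∫ x, f x ∂(j.posPart + ν) = ∫ x, f x ∂(μ + j.negPart) := by rw [h1]
  rw [integral_add_measure (cont_int hf _) (cont_int hf _),
    integral_add_measure (cont_int hf _) (cont_int hf _)] at h2
  exact sub_eq_sub_iff_add_eq_add.2 h2

theorem sInt_add {f : Circle2pi → V} (hf : Continuous f) (w v : SignedMeasure Circle2pi) :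
    sInt (w + v) f = sInt w f + sInt v f := by
  rw [sInt_of_sub hf (w + v)
    (w.toJordanDecomposition.posPart + v.toJordanDecomposition.posPart)
    (w.toJordanDecomposition.negPart + v.toJordanDecomposition.negPart)]
  · rw [integral_add_measure (cont_int hf _) (cont_int hf _),
      integral_add_measure (cont_int hf _) (cont_int hf _)]
    unfold sInt
    abel
  · rw [Measure.toSignedMeasure_add, Measure.toSignedMeasure_add]
    conv_lhs => rw [sm_eq w, sm_eq v]
    abel

theorem sInt_neg (f : Circle2pi → V) (w : SignedMeasure Circle2pi) :
    sInt (-w) f = - sInt w f := by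
  unfold sInt
  rw [SignedMeasure.toJordanDecomposition_neg]
  simp

theorem sInt_smul_nn (f : Circle2pi → V) (c : NNReal) (w : SignedMeasure Circle2pi) :
    sInt (c • w) f = c • sInt w f := by
  unfold sInt
  rw [SignedMeasure.toJordanDecomposition_smul]
  simp only [JordanDecomposition.smul_posPart, JordanDecomposition.smul_negPart,
    integral_smul_nnreal_measure]
  rw [smul_sub]

theorem sInt_smul (f : Circle2pi → V) (c : ℝ) (w : SignedMeasure Circle2pi) :
    sInt (c • w) f = c • sInt w f := by
  rcases le_total 0 c with h | h
  · lift c to NNReal using h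
    exact sInt_smul_nn f c w
  · obtain ⟨b, rfl⟩ : ∃ b, c = -b := ⟨-c, by simp⟩
    lift b to NNReal using (by linarith)
    have := sInt_smul_nn f b w
    have h2 : (-(b:ℝ)) • w = -(b • w) := neg_smul (b:ℝ) w
    rw [h2, sInt_neg, neg_smul, this]
    rfl

/-- Integration as a linear map. -/
noncomputable def sIntL (f : Circle2pi → V) (hf : Continuous f) :
    SignedMeasure Circle2pi →ₗ[ℝ] V where
  toFun w := sInt w f
  map_add' := sInt_add hf
  map_smul' := sInt_smul f

theorem sInt_dirac [CompleteSpace V] {f : Circle2pi → V} (hf : Continuous f) (x : Circle2pi) :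
    sInt (diracSM x) f = f x := by
  rw [sInt_of_sub hf (diracSM x) (Measure.dirac x) 0]
  · simp
  · simp [diracSM]

theorem sInt_one (w : SignedMeasure Circle2pi) : sInt w (fun _ => (1:ℝ)) = w Set.univ := by
  conv_rhs => rw [sm_eq w]
  rw [Measure.toSignedMeasure_sub_apply MeasurableSet.univ]
  simp [sInt]

theorem sInt_clm {V' : Type*} [NormedAddCommGroup V'] [NormedSpace ℝ V'] [CompleteSpace V]
    [CompleteSpace V']
    (L : V →L[ℝ] V') {f : Circle2pi → V} (hf : Continuous f) (w : SignedMeasure Circle2pi) :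
    L (sInt w f) = sInt w (fun x => L (f x)) := by
  unfold sInt
  rw [map_sub, ContinuousLinearMap.integral_comp_comm _ (cont_int hf _),
    ContinuousLinearMap.integral_comp_comm _ (cont_int hf _)]

end

/-! ## Trigonometric polynomials -/

/-- The measurement space. -/
abbrev Zs (Kc : ℕ) : Type := ℝ × (Fin Kc → ℂ)

/-- The moment curve. -/
noncomputable def mcurve (Kc : ℕ) (x : Circle2pi) : Zs Kc :=
  (1, fun k => fourier (-((k.1 : ℤ) + 1)) x)

theorem mcurve_cont (Kc : ℕ) : Continuous (mcurve Kc) := by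
  unfold mcurve
  refine continuous_const.prodMk (continuous_pi fun k => ?_)
  exact ContinuousMap.continuous _

theorem dual_repr {Kc : ℕ} (l : Zs Kc →L[ℝ] ℝ) (s : ℝ) (v : Fin Kc → ℂ) :
    l (s, v) = l (1, 0) * s + ∑ k, (((l (0, Pi.single k 1) : ℂ) -
      (l (0, Pi.single k Complex.I) : ℂ) * Complex.I) * v k).re := by
  classical
  have h1 : ((s, v) : Zs Kc) = s • ((1, 0) : Zs Kc) + ∑ k, ((v k).re • ((0, Pi.single k 1) : Zs Kc)
      + (v k).im • ((0, Pi.single k Complex.I) : Zs Kc)) := by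
    ext j
    · simp [Prod.fst_sum]
    · simp only [Prod.snd_add, Prod.smul_snd, smul_zero, Prod.snd_sum, Finset.sum_apply,
        Pi.add_apply, Pi.smul_apply, Pi.single_apply]
      rw [Finset.sum_eq_single j]
      · simp only [if_true]
        simp
      · intro b _ hb
        simp [hb.symm]
      · simp
  rw [h1, map_add, map_sum, map_smul]
  congr 1
  · simp [mul_comm]
  · refine Finset.sum_congr rfl fun k _ => ?_
    rw [map_add, map_smul, map_smul]
    simp
    ring

open Polynomial in
theorem trig_roots {Kc : ℕ} (l : Zs Kc →L[ℝ] ℝ) (hl : l ≠ 0) :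
    {x | l (mcurve Kc x) = 0}.Finite ∧ {x | l (mcurve Kc x) = 0}.ncard ≤ 2 * Kc := by
  classical
  set b : Fin Kc → ℂ := fun k => (l (0, Pi.single k 1) : ℂ) -
      (l (0, Pi.single k Complex.I) : ℂ) * Complex.I with hb
  set P : ℂ[X] := C (l (1,0) : ℂ) * X ^ Kc + ∑ k : Fin Kc, (C (b k / 2) * X ^ (Kc - (k.1 + 1)) +
    C ((starRingEnd ℂ) (b k) / 2) * X ^ (Kc + (k.1 + 1))) with hP
  have hP0 : P ≠ 0 := by
    intro h0
    apply hl
    have hβ : (l (1,0) : ℂ) = 0 := by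
      have := congrArg (fun p => p.coeff Kc) h0
      simp only [hP, coeff_add, finsetSum_coeff, coeff_C_mul, coeff_X_pow, coeff_zero] at this
      rw [Finset.sum_eq_zero] at this
      · simpa using this
      · intro k _
        have h1 : Kc ≠ Kc - (k.1 + 1) := by have := k.2; omega
        have h2 : Kc ≠ Kc + (k.1 + 1) := by omega
        rw [if_neg h1, if_neg h2]; simp
    have hbz : ∀ j, b j = 0 := by
      intro j
      have := congrArg (fun p => p.coeff (Kc + (j.1 + 1))) h0
      simp only [hP, coeff_add, finsetSum_coeff, coeff_C_mul, coeff_X_pow, coeff_zero] at this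
      rw [Finset.sum_eq_single j] at this
      · have h1 : Kc + (j.1 + 1) ≠ Kc - (j.1 + 1) := by omega
        have h2 : Kc + (j.1 + 1) ≠ Kc := by omega
        rw [if_neg h1, if_neg h2] at this
        simpa using this
      · intro k _ hk
        have h1 : Kc + (j.1 + 1) ≠ Kc - (k.1 + 1) := by omega
        have h2 : Kc + (j.1 + 1) ≠ Kc + (k.1 + 1) := by
          intro h; apply hk; ext; omega
        rw [if_neg h1, if_neg h2]; simp
      · simp
    refine ContinuousLinearMap.ext fun p => ?_
    have h1 := dual_repr l p.1 p.2
    have h2 : ∀ k, (l (0, Pi.single k 1) : ℂ) -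
        (l (0, Pi.single k Complex.I) : ℂ) * Complex.I = 0 := hbz
    have h3 : l (1, 0) = 0 := by exact_mod_cast hβ
    simp only [h2, h3] at h1
    simpa using h1
  have hdeg : P.natDegree ≤ 2 * Kc := by
    rw [hP]
    refine natDegree_add_le_of_degree_le ?_ (natDegree_sum_le_of_forall_le _ _ ?_)
    · exact (natDegree_C_mul_X_pow_le _ _).trans (by omega)
    · intro k _
      have := k.2
      refine natDegree_add_le_of_degree_le ?_ ?_
      · exact (natDegree_C_mul_X_pow_le _ _).trans (by omega)
      · exact (natDegree_C_mul_X_pow_le _ _).trans (by omega)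
  have heval : ∀ x, P.eval (AddCircle.toCircle x : ℂ) =
      (AddCircle.toCircle x : ℂ) ^ Kc * (l (mcurve Kc x) : ℂ) := by
    intro x
    have hz : (AddCircle.toCircle x : ℂ) ≠ 0 := Circle.coe_ne_zero _
    rw [mcurve, dual_repr l]
    simp only [hP, eval_add, eval_mul, eval_C, eval_pow, eval_X, eval_finsetSum]
    push_cast
    rw [mul_add, Finset.mul_sum]
    congr 1
    · ring
    · refine Finset.sum_congr rfl fun k _ => ?_
      change _ = _ * (((b k * _).re : ℝ) : ℂ)
      have hre : ∀ u : ℂ, ((u.re : ℝ) : ℂ) = (u + (starRingEnd ℂ) u) / 2 := by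
        intro u; rw [Complex.add_conj]; push_cast; ring
      rw [hre, map_mul, ← fourier_neg]
      have h1 : (fourier (-((k.1:ℤ) + 1)) x : ℂ) * (AddCircle.toCircle x : ℂ) ^ Kc
          = (AddCircle.toCircle x : ℂ) ^ (Kc - (k.1 + 1)) := by
        rw [fourier_apply, AddCircle.toCircle_zsmul, Circle.coe_zpow, ← zpow_natCast,
          ← zpow_natCast, ← zpow_add₀ hz]
        congr 1
        have := k.2
        omega
      have h2 : (fourier (- -((k.1:ℤ) + 1)) x : ℂ) * (AddCircle.toCircle x : ℂ) ^ Kc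
          = (AddCircle.toCircle x : ℂ) ^ (Kc + (k.1 + 1)) := by
        rw [fourier_apply, AddCircle.toCircle_zsmul, Circle.coe_zpow, ← zpow_natCast,
          ← zpow_natCast, ← zpow_add₀ hz]
        congr 1
        push_cast
        ring
      rw [← h1, ← h2]
      ring
  have hsub : Set.MapsTo (fun x : Circle2pi => (AddCircle.toCircle x : ℂ))
      {x | l (mcurve Kc x) = 0} (P.roots.toFinset : Set ℂ) := by
    intro x hx
    simp only [Set.mem_ofPred_eq] at hx
    simp [hP0, heval, hx]
  have hinj : Set.InjOn (fun x : Circle2pi => (AddCircle.toCircle x : ℂ))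
      {x | l (mcurve Kc x) = 0} := by
    intro x _ y _ hxy
    exact AddCircle.injective_toCircle (by positivity) (Circle.coe_injective hxy)
  refine ⟨Set.Finite.of_injOn hsub hinj (Finset.finite_toSet _), ?_⟩
  refine (Set.ncard_le_ncard_of_injOn _ hsub hinj (Finset.finite_toSet _)).trans ?_
  rw [Set.ncard_coe_finset]
  exact (Multiset.toFinset_card_le _).trans ((card_roots' P).trans hdeg)

/-- The derivation operator on moment space. -/
noncomputable def dOp (Kc : ℕ) : Zs Kc →L[ℝ] Zs Kc :=
  LinearMap.toContinuousLinearMap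
    { toFun := fun p => (0, fun k => (-((k.1 : ℂ) + 1) * Complex.I) * p.2 k)
      map_add' := by
        intro p q
        ext j
        · simp
        · simp [mul_add]
      map_smul' := by
        intro c p
        ext j
        · simp
        · simp; ring }

theorem mcurve_deriv (Kc : ℕ) (t : ℝ) :
    HasDerivAt (fun t : ℝ => mcurve Kc (t : Circle2pi)) (dOp Kc (mcurve Kc (t : Circle2pi))) t := by
  have : HasDerivAt (fun t : ℝ => ((1 : ℝ), fun k : Fin Kc =>
      (fourier (-((k.1 : ℤ) + 1)) (t : Circle2pi) : ℂ)))
      ((0 : ℝ), fun k : Fin Kc => (-((k.1 : ℂ) + 1) * Complex.I) *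
        (fourier (-((k.1 : ℤ) + 1)) (t : Circle2pi) : ℂ)) t := by
    refine (hasDerivAt_const t (1:ℝ)).prodMk (hasDerivAt_pi.2 fun k => ?_)
    have := hasDerivAt_fourier (2 * Real.pi) (-((k.1 : ℤ) + 1)) t
    have hpi : (Real.pi : ℂ) ≠ 0 := by exact_mod_cast Real.pi_ne_zero
    have h2 : (2 * (Real.pi : ℂ) * Complex.I * ((-((k.1 : ℤ) + 1) : ℤ) : ℂ) /
        ((2 * Real.pi : ℝ) : ℂ)) = (-((k.1 : ℂ) + 1) * Complex.I) := by
      push_cast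
      field_simp
    rw [h2] at this
    exact this
  exact this

theorem trig_ext {Kc : ℕ} (l : Zs Kc →L[ℝ] ℝ) (hl : ∀ x, |l (mcurve Kc x)| ≤ 1)
    (v : Fin Kc → ℂ) (hv : l (0, v) ≠ 0) :
    {x | |l (mcurve Kc x)| = 1}.Finite ∧ {x | |l (mcurve Kc x)| = 1}.ncard ≤ 2 * Kc := by
  have hne : l.comp (dOp Kc) ≠ 0 := by
    intro h
    apply hv
    have := congrArg (fun f => f ((0, fun k => ((-((k.1 : ℂ) + 1) * Complex.I))⁻¹ * v k) :
      Zs Kc)) h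
    simp only [ContinuousLinearMap.comp_apply, zero_apply] at this
    have key : ((0, v) : Zs Kc) =
        dOp Kc (0, fun k => ((-((k.1 : ℂ) + 1) * Complex.I))⁻¹ * v k) := by
      refine Prod.ext rfl (funext fun k => ?_)
      have h1 : (k.1 : ℂ) + 1 ≠ 0 := by exact_mod_cast Nat.succ_ne_zero k.1
      have h2 : (-((k.1 : ℂ) + 1) * Complex.I) ≠ 0 :=
        mul_ne_zero (neg_ne_zero.2 h1) Complex.I_ne_zero
      change v k = (-((k.1 : ℂ) + 1) * Complex.I) * ((-((k.1 : ℂ) + 1) * Complex.I)⁻¹ * v k)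
      rw [mul_inv_cancel_left₀ h2]
    rw [key]
    exact this
  obtain ⟨hf, hc⟩ := trig_roots _ hne
  have hsub : {x | |l (mcurve Kc x)| = 1} ⊆ {x | (l.comp (dOp Kc)) (mcurve Kc x) = 0} := by
    intro x hx
    simp only [Set.mem_ofPred_eq] at hx ⊢
    induction x using QuotientAddGroup.induction_on with
    | H t =>
    have hd : HasDerivAt (fun t : ℝ => l (mcurve Kc (t : Circle2pi)))
      (l (dOp Kc (mcurve Kc (t : Circle2pi)))) t := l.hasFDerivAt.comp_hasDerivAt t (mcurve_deriv Kc t)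
    rcases (abs_eq zero_le_one).1 hx with h | h
    · have : IsLocalMax (fun t : ℝ => l (mcurve Kc (t : Circle2pi))) t := by
        refine Eventually.of_forall fun s => ?_
        have := (abs_le.1 (hl (s : Circle2pi))).2
        exact this.trans h.ge
      exact this.hasDerivAt_eq_zero hd
    · have : IsLocalMin (fun t : ℝ => l (mcurve Kc (t : Circle2pi))) t := by
        refine Eventually.of_forall fun s => ?_
        have := (abs_le.1 (hl (s : Circle2pi))).1
        exact h.le.trans this
      exact this.hasDerivAt_eq_zero hd
  exact ⟨hf.subset hsub, (Set.ncard_le_ncard hsub hf).trans hc⟩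

theorem trig_interp {Kc : ℕ} (S : Finset Circle2pi) (hS : S.card ≤ 2 * Kc + 1)
    (g : Circle2pi → ℝ) :
    ∃ l : Zs Kc →L[ℝ] ℝ, ∀ x ∈ S, l (mcurve Kc x) = g x := by
  classical
  have : Infinite Circle2pi := by
    have : Infinite (Set.Ico (0:ℝ) (0 + 2 * Real.pi)) := by
      apply Set.Infinite.to_subtype
      exact Set.Ico_infinite (by positivity)
    exact Infinite.of_injective _ (AddCircle.equivIco (2 * Real.pi) 0).symm.injective
  obtain ⟨T, hST, hT⟩ := Infinite.exists_superset_card_eq S _ hS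
  let A : (Zs Kc →L[ℝ] ℝ) →ₗ[ℝ] (T → ℝ) :=
    { toFun := fun l x => l (mcurve Kc x)
      map_add' := fun _ _ => rfl
      map_smul' := fun _ _ => rfl }
  have hinj : Function.Injective A := by
    rw [injective_iff_map_eq_zero]
    intro l h
    by_contra hl
    obtain ⟨hf, hc⟩ := trig_roots l hl
    have hsub : (T : Set Circle2pi) ⊆ {x | l (mcurve Kc x) = 0} := by
      intro x hx
      exact congrFun h ⟨x, hx⟩
    have := Set.ncard_le_ncard hsub hf
    rw [Set.ncard_coe_finset] at this
    omega
  have hdim : Module.finrank ℝ (Zs Kc →L[ℝ] ℝ) = Module.finrank ℝ (T → ℝ) := by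
    rw [← (LinearMap.toContinuousLinearMap (𝕜 := ℝ) (E := Zs Kc) (F' := ℝ)).finrank_eq,
      Module.finrank_linearMap, Module.finrank_prod, Module.finrank_pi_fintype]
    simp [Complex.finrank_real_complex, hT]
    ring
  have hsurj := (LinearMap.injective_iff_surjective_of_finrank_eq_finrank hdim).1 hinj
  obtain ⟨l, hl⟩ := hsurj (fun x => g x)
  exact ⟨l, fun x hx => congrFun hl ⟨x, hST hx⟩⟩

theorem mcurve_span (Kc : ℕ) : Submodule.span ℝ (Set.range (mcurve Kc)) = ⊤ := by
  by_contra h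
  obtain ⟨f, hf, hf2⟩ := Submodule.exists_le_ker_of_lt_top _ (lt_top_iff_ne_top.2 h)
  have hne : LinearMap.toContinuousLinearMap f ≠ 0 := by
    intro h; apply hf
    refine LinearMap.ext fun p => ?_
    exact congrArg (fun g : Zs Kc →L[ℝ] ℝ => g p) h
  obtain ⟨h1, h2⟩ := trig_roots _ hne
  have : {x | LinearMap.toContinuousLinearMap f (mcurve Kc x) = 0} = Set.univ := by
    ext x; simp only [Set.mem_ofPred_eq, Set.mem_univ, iff_true]
    exact hf2 (Submodule.subset_span ⟨x, rfl⟩)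
  rw [this] at h1
  have : Infinite Circle2pi := by
    have : Infinite (Set.Ico (0:ℝ) (0 + 2 * Real.pi)) := by
      apply Set.Infinite.to_subtype
      exact Set.Ico_infinite (by positivity)
    exact Infinite.of_injective _ (AddCircle.equivIco (2 * Real.pi) 0).symm.injective
  exact Set.infinite_univ h1

/-! ## Moments -/

/-- The moment map on signed measures. -/
noncomputable def mom (Kc : ℕ) : SignedMeasure Circle2pi →ₗ[ℝ] Zs Kc :=
  sIntL (mcurve Kc) (mcurve_cont Kc)

theorem mom_fst (Kc : ℕ) (w : SignedMeasure Circle2pi) : (mom Kc w).1 = w Set.univ := by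
  rw [← sInt_one w]
  exact sInt_clm (ContinuousLinearMap.fst ℝ ℝ (Fin Kc → ℂ)) (mcurve_cont Kc) w

theorem mom_snd (Kc : ℕ) (w : SignedMeasure Circle2pi) (k : Fin Kc) :
    (mom Kc w).2 k = fCoeff w ((k.1 : ℤ) + 1) := by
  exact sInt_clm ((ContinuousLinearMap.proj (R := ℝ) (φ := fun _ : Fin Kc => ℂ) k).comp
    (ContinuousLinearMap.snd ℝ ℝ (Fin Kc → ℂ))) (mcurve_cont Kc) w

theorem mom_dirac (Kc : ℕ) (x : Circle2pi) : mom Kc (diracSM x) = mcurve Kc x :=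
  sInt_dirac (mcurve_cont Kc) x

/-- The unit ball in moment space. -/
noncomputable def Kb (Kc : ℕ) : Set (Zs Kc) :=
  convexHull ℝ (Set.range (mcurve Kc) ∪ Set.range (fun x => - mcurve Kc x))

theorem Kb_convex (Kc : ℕ) : Convex ℝ (Kb Kc) := convex_convexHull _ _

theorem Kb_compact (Kc : ℕ) : IsCompact (Kb Kc) :=
  aux_convexHull_compact ((isCompact_range (mcurve_cont Kc)).union
    (isCompact_range (mcurve_cont Kc).neg))

theorem Kb_mem (Kc : ℕ) (x : Circle2pi) : mcurve Kc x ∈ Kb Kc :=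
  subset_convexHull _ _ (Or.inl ⟨x, rfl⟩)

theorem Kb_mem_neg (Kc : ℕ) (x : Circle2pi) : - mcurve Kc x ∈ Kb Kc :=
  subset_convexHull _ _ (Or.inr ⟨x, rfl⟩)

theorem Kb_neg (Kc : ℕ) : -(Kb Kc) = Kb Kc := by
  unfold Kb
  rw [← convexHull_neg, Set.union_neg, Set.union_comm]
  congr 2
  · ext y; simp [neg_eq_iff_eq_neg]
  · ext y; simp [neg_eq_iff_eq_neg]

theorem Kb_neg_mem {Kc : ℕ} {k : Zs Kc} (h : k ∈ Kb Kc) : -k ∈ Kb Kc := by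
  rw [← Kb_neg] at h
  exact h

theorem Kb_zero (Kc : ℕ) : (0 : Zs Kc) ∈ Kb Kc := by
  have := (Kb_convex Kc) (Kb_mem Kc 0) (Kb_mem_neg Kc 0) (a := 1/2) (b := 1/2)
    (by norm_num) (by norm_num) (by norm_num)
  simpa using this

theorem int_mem (Kc : ℕ) (μ : Measure Circle2pi) [IsFiniteMeasure μ] :
    ∃ k ∈ Kb Kc, ∫ x, mcurve Kc x ∂μ = μ.real Set.univ • k := by
  by_cases h : μ = 0
  · exact ⟨0, Kb_zero Kc, by simp [h]⟩
  · have : NeZero μ := ⟨h⟩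
    refine ⟨⨍ x, mcurve Kc x ∂μ, ?_, ?_⟩
    · exact (Kb_convex Kc).average_mem (Kb_compact Kc).isClosed
        (Eventually.of_forall fun x => Kb_mem Kc x) (cont_int (mcurve_cont Kc) μ)
    · rw [average_eq, smul_smul, mul_inv_cancel₀, one_smul]
      rw [Ne, measureReal_eq_zero_iff, Measure.measure_univ_eq_zero]
      exact h

open Pointwise in
theorem mom_mem (Kc : ℕ) (w : SignedMeasure Circle2pi) :
    ∃ k ∈ Kb Kc, mom Kc w = tvNorm w • k := by
  obtain ⟨k1, hk1, h1⟩ := int_mem Kc w.toJordanDecomposition.posPart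
  obtain ⟨k2, hk2, h2⟩ := int_mem Kc w.toJordanDecomposition.negPart
  have h : mom Kc w ∈ tvNorm w • Kb Kc := by
    rw [tv_eq, (Kb_convex Kc).add_smul measureReal_nonneg measureReal_nonneg]
    refine ⟨_, ⟨k1, hk1, rfl⟩, _, ⟨-k2, Kb_neg_mem hk2, rfl⟩, ?_⟩
    change _ = sInt w (mcurve Kc)
    unfold sInt
    rw [h1, h2]
    simp [sub_eq_add_neg]
  obtain ⟨k, hk, h⟩ := h
  exact ⟨k, hk, h.symm⟩

theorem Kb_real {Kc : ℕ} {k : Zs Kc} (hk : k ∈ Kb Kc) :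
    ∃ w : SignedMeasure Circle2pi, mom Kc w = k ∧ tvNorm w ≤ 1 := by
  have hC : Convex ℝ {k : Zs Kc | ∃ w : SignedMeasure Circle2pi, mom Kc w = k ∧ tvNorm w ≤ 1} := by
    rintro _ ⟨w, rfl, hw⟩ _ ⟨v, rfl, hv⟩ a b ha hb hab
    refine ⟨a • w + b • v, by simp, ?_⟩
    refine (tv_add _ _).trans ?_
    rw [tv_smul, tv_smul, abs_of_nonneg ha, abs_of_nonneg hb]
    nlinarith
  refine convexHull_min ?_ hC hk
  rintro _ (⟨x, rfl⟩ | ⟨x, rfl⟩)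
  · exact ⟨diracSM x, mom_dirac Kc x, (tv_dirac x).le⟩
  · refine ⟨(-1 : ℝ) • diracSM x, by simp [mom_dirac], ?_⟩
    rw [tv_smul, tv_dirac]; simp

theorem Kb_real_smul {Kc : ℕ} {k : Zs Kc} (hk : k ∈ Kb Kc) {r : ℝ} (hr : 0 ≤ r) :
    ∃ w : SignedMeasure Circle2pi, mom Kc w = r • k ∧ tvNorm w ≤ r := by
  obtain ⟨w, h1, h2⟩ := Kb_real hk
  refine ⟨r • w, by rw [map_smul, h1], ?_⟩
  rw [tv_smul, abs_of_nonneg hr]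
  nlinarith

theorem mom_surj (Kc : ℕ) (z : Zs Kc) : ∃ w, mom Kc w = z := by
  have : LinearMap.range (mom Kc) = ⊤ := by
    rw [eq_top_iff, ← mcurve_span, Submodule.span_le]
    rintro _ ⟨x, rfl⟩
    exact ⟨diracSM x, mom_dirac Kc x⟩
  exact LinearMap.range_eq_top.1 this z

theorem Kb_interior (Kc : ℕ) : (interior (Kb Kc)).Nonempty := by
  rw [(Kb_convex Kc).interior_nonempty_iff_affineSpan_eq_top]
  rw [← Set.insert_eq_of_mem (Kb_zero Kc)]
  rw [← AffineSubspace.coe_eq_univ_iff, affineSpan_insert_zero]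
  have : Submodule.span ℝ (Kb Kc) = ⊤ := by
    rw [eq_top_iff, ← mcurve_span]
    apply Submodule.span_mono
    rintro _ ⟨x, rfl⟩
    exact Kb_mem Kc x
  rw [this]; rfl

/-- Existence of a dual certificate. -/
theorem cert {Kc : ℕ} (c : Zs Kc) (r : ℝ) (hr : 0 < r)
    (hmin : ∀ w, mom Kc w = c → r ≤ tvNorm w) :
    ∃ l : Zs Kc →L[ℝ] ℝ, (∀ x, |l (mcurve Kc x)| ≤ 1) ∧ r ≤ l c := by
  set k : Zs Kc := r⁻¹ • c with hk
  have hnot : k ∉ interior (Kb Kc) := by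
    intro hi
    have hcont : Continuous (fun t : ℝ => t • k) := by fun_prop
    have h1 : ∀ᶠ t in nhds (1:ℝ), t • k ∈ interior (Kb Kc) := by
      apply hcont.continuousAt.eventually_mem
      rw [one_smul]
      exact isOpen_interior.mem_nhds hi
    obtain ⟨ε, hε, hb⟩ := Metric.eventually_nhds_iff.1 h1
    have h2 := interior_subset (hb (y := 1 + ε/2) (by
      rw [Real.dist_eq]; rw [abs_lt]; constructor <;> linarith))
    obtain ⟨w, hw, htv⟩ := Kb_real_smul h2 (r := r / (1 + ε/2)) (by positivity)
    have h3 : mom Kc w = c := by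
      rw [hw, hk, smul_smul, smul_smul]
      have : r / (1 + ε/2) * ((1 + ε/2) * r⁻¹) = 1 := by field_simp
      rw [mul_assoc, this, one_smul]
    have h4 := hmin w h3
    have h5 : r / (1 + ε/2) < r := by
      rw [div_lt_iff₀ (by positivity)]
      nlinarith
    linarith
  obtain ⟨f, hf⟩ := geometric_hahn_banach_open_point (Kb_convex Kc).interior isOpen_interior hnot
  have hle : ∀ y ∈ Kb Kc, f y ≤ f k := by
    intro y hy
    have hy' : y ∈ closure (interior (Kb Kc)) := by
      rw [(Kb_convex Kc).closure_interior_eq_closure_of_nonempty_interior (Kb_interior Kc)]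
      exact subset_closure hy
    have hcl : IsClosed {y | f y ≤ f k} := isClosed_le f.continuous continuous_const
    exact closure_minimal (fun a ha => (hf a ha).le) hcl hy'
  have hpos : 0 < f k := by
    obtain ⟨a, ha⟩ := Kb_interior Kc
    have h1 := hf a ha
    have h2 := hle (-a) (Kb_neg_mem (interior_subset ha))
    rw [map_neg] at h2
    linarith
  refine ⟨(f k)⁻¹ • f, fun x => ?_, ?_⟩
  · have h1 := hle _ (Kb_mem Kc x)
    have h2 := hle _ (Kb_mem_neg Kc x)
    rw [map_neg] at h2
    simp only [smul_apply, smul_eq_mul]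
    rw [abs_mul, abs_of_pos (inv_pos.2 hpos), inv_mul_le_iff₀ hpos, mul_one, abs_le]
    constructor <;> linarith
  · have : c = r • k := by rw [hk, smul_smul, mul_inv_cancel₀ hr.ne', one_smul]
    rw [this]
    simp only [smul_apply, smul_eq_mul, map_smul]
    apply le_of_eq
    field_simp

theorem supp_cert {Kc : ℕ} (l : Zs Kc →L[ℝ] ℝ) (hl : ∀ x, |l (mcurve Kc x)| ≤ 1)
    (w : SignedMeasure Circle2pi) (hw : tvNorm w ≤ l (mom Kc w)) :
    (∀ᵐ x ∂w.toJordanDecomposition.posPart, |l (mcurve Kc x)| = 1) ∧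
    (∀ᵐ x ∂w.toJordanDecomposition.negPart, |l (mcurve Kc x)| = 1) := by
  have hc : Continuous fun x => l (mcurve Kc x) := l.continuous.comp (mcurve_cont Kc)
  have h1 : l (mom Kc w) = sInt w (fun x => l (mcurve Kc x)) := sInt_clm l (mcurve_cont Kc) w
  rw [h1, tv_eq] at hw
  unfold sInt at hw
  have gen : ∀ (μ : Measure Circle2pi) [IsFiniteMeasure μ] (q : Circle2pi → ℝ), Continuous q →
      (∀ x, |q x| ≤ 1) → ∫ x, q x ∂μ ≤ μ.real Set.univ ∧
        (μ.real Set.univ ≤ ∫ x, q x ∂μ → ∀ᵐ x ∂μ, |q x| = 1) := by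
    intro μ _ q hq hq1
    have hi : ∫ x, (1 - q x) ∂μ = μ.real Set.univ - ∫ x, q x ∂μ := by
      rw [integral_sub (integrable_const _) (cont_int hq μ)]
      simp
    have hnn : 0 ≤ fun x => 1 - q x := fun x => by
      have := (abs_le.1 (hq1 x)).2
      simp only [Pi.zero_apply]
      linarith
    have h0 : 0 ≤ ∫ x, (1 - q x) ∂μ := integral_nonneg hnn
    refine ⟨by linarith, fun hle => ?_⟩
    have hz : ∫ x, (1 - q x) ∂μ = 0 := le_antisymm (by linarith) h0
    rw [integral_eq_zero_iff_of_nonneg hnn (cont_int (continuous_const.sub hq) μ)] at hz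
    filter_upwards [hz] with x hx
    have : q x = 1 := by
      have : 1 - q x = 0 := hx
      linarith
    rw [this, abs_one]
  obtain ⟨a1, a2⟩ := gen w.toJordanDecomposition.posPart _ hc hl
  obtain ⟨b1, b2⟩ := gen w.toJordanDecomposition.negPart (fun x => - l (mcurve Kc x)) hc.neg
    (fun x => by rw [abs_neg]; exact hl x)
  simp only [integral_neg, abs_neg] at b1 b2
  exact ⟨a2 (by linarith), b2 (by linarith)⟩

theorem meas_discrete (μ : Measure Circle2pi) [IsFiniteMeasure μ] (S : Finset Circle2pi)
    (h : ∀ᵐ x ∂μ, x ∈ S) (A : Set Circle2pi) (hA : MeasurableSet A) :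
    μ.real A = ∑ x ∈ S, μ.real {x} * A.indicator 1 x := by
  have h1 : μ.restrict (S : Set Circle2pi) = μ := Measure.restrict_eq_self_of_ae_mem h
  have h2 : μ.real A = ∫ x, A.indicator (1 : Circle2pi → ℝ) x ∂μ := (integral_indicator_one hA).symm
  rw [h2]
  conv_lhs => rw [← h1]
  rw [setIntegral_finset]
  · simp
  · apply Integrable.integrableOn
    exact (integrable_indicator_iff hA).2 (integrable_const _).integrableOn

theorem sm_discrete (w : SignedMeasure Circle2pi) (S : Finset Circle2pi)
    (h1 : ∀ᵐ x ∂w.toJordanDecomposition.posPart, x ∈ S)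
    (h2 : ∀ᵐ x ∂w.toJordanDecomposition.negPart, x ∈ S) :
    w = ∑ x ∈ S, w {x} • diracSM x := by
  ext A hA
  have hval : ∀ B, MeasurableSet B → w B = w.toJordanDecomposition.posPart.real B -
      w.toJordanDecomposition.negPart.real B := by
    intro B hB
    conv_lhs => rw [sm_eq w]
    exact Measure.toSignedMeasure_sub_apply hB
  rw [hval A hA, meas_discrete _ S h1 A hA, meas_discrete _ S h2 A hA, ← Finset.sum_sub_distrib]
  have : (∑ x ∈ S, w {x} • diracSM x) A = ∑ x ∈ S, w {x} * diracSM x A := by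
    let F : SignedMeasure Circle2pi →+ ℝ :=
      { toFun := fun v => v A, map_zero' := rfl, map_add' := fun _ _ => rfl }
    exact map_sum F (fun x => w {x} • diracSM x) S
  rw [this]
  refine Finset.sum_congr rfl fun x _ => ?_
  rw [hval _ (measurableSet_singleton x), diracSM, Measure.toSignedMeasure_apply_measurable hA]
  rw [sub_mul]
  have : (Measure.dirac x).real A = A.indicator 1 x := by
    rw [measureReal_def, Measure.dirac_apply' x hA]
    by_cases hx : x ∈ A <;> simp [hx]
  rw [this]

theorem discrete_unique {Kc : ℕ} (S : Finset Circle2pi) (hS : S.card ≤ 2 * Kc + 1)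
    (a b : Circle2pi → ℝ)
    (h : mom Kc (∑ x ∈ S, a x • diracSM x) = mom Kc (∑ x ∈ S, b x • diracSM x)) :
    ∀ x ∈ S, a x = b x := by
  classical
  intro x hx
  obtain ⟨l, hl⟩ := trig_interp (Kc := Kc) S hS (fun y => if y = x then 1 else 0)
  have key : ∀ a : Circle2pi → ℝ, l (mom Kc (∑ x ∈ S, a x • diracSM x)) = a x := by
    intro a
    simp only [map_sum, map_smul, mom_dirac, smul_eq_mul]
    rw [Finset.sum_congr rfl (fun y hy => by rw [hl y hy])]
    simp [hx]
  rw [← key a, ← key b, h]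

/-! ## The optimization problem -/

/-- Measurement in terms of moments. -/
noncomputable def zmap (M Kc : ℕ) (a : ℝ) (c : Zs Kc) : Zs Kc :=
  (a, fun k => c.2 k / (Complex.I * ((k.1 + 1 : ℕ) : ℂ)) ^ M)

theorem nuMap_eq (M Kc : ℕ) (w : SignedMeasure Circle2pi) (a : ℝ) :
    nuMap M Kc w a = zmap M Kc a (mom Kc w) := by
  unfold nuMap zmap
  simp only [mom_snd]

theorem zmap_cont (M Kc : ℕ) : Continuous fun p : ℝ × Zs Kc => zmap M Kc p.1 p.2 := by
  unfold zmap
  refine continuous_fst.prodMk (continuous_pi fun k => ?_)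
  have : Continuous fun p : ℝ × Zs Kc => p.2.2 k := by fun_prop
  exact this.div_const _

theorem den_ne (M k : ℕ) : (Complex.I * ((k + 1 : ℕ) : ℂ)) ^ M ≠ 0 :=
  pow_ne_zero _ (mul_ne_zero Complex.I_ne_zero (by exact_mod_cast Nat.succ_ne_zero k))

theorem exists_min {M Kc : ℕ} {lam : ℝ} (hlam : 0 < lam)
    {E : ℝ × (Fin Kc → ℂ) → ℝ≥0∞} (hE : Admissible E) :
    ∃ (w : SignedMeasure Circle2pi) (a : ℝ), w Set.univ = 0 ∧ penJ M E lam w a ≠ ∞ ∧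
      ∀ (w' : SignedMeasure Circle2pi) (a' : ℝ), w' Set.univ = 0 →
        penJ M E lam w a ≤ penJ M E lam w' a' := by
  -- a feasible point
  obtain ⟨z0, hz0⟩ := hE.proper
  obtain ⟨w0, hw0⟩ := mom_surj Kc
    ((0, fun k => z0.2 k * (Complex.I * ((k.1 + 1 : ℕ) : ℂ)) ^ M) : Zs Kc)
  have hw0z : w0 Set.univ = 0 := by rw [← mom_fst Kc, hw0]
  have hnu0 : nuMap M Kc w0 z0.1 = z0 := by
    rw [nuMap_eq, hw0]
    refine Prod.ext rfl (funext fun k => ?_)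
    exact mul_div_cancel_right₀ _ (den_ne M k.1)
  set J0 := penJ M E lam w0 z0.1 with hJ0
  have hJ0f : J0 ≠ ∞ := by
    rw [hJ0, penJ, hnu0]
    exact ENNReal.add_ne_top.2 ⟨hz0, ENNReal.ofReal_ne_top⟩
  -- coercivity
  obtain ⟨A, hA⟩ : ∃ A : ℝ, ∀ z : Zs Kc, A ≤ ‖z‖ → J0 < E z := by
    have h1 : ∀ᶠ z in Filter.comap norm Filter.atTop, J0 < E z :=
      hE.coercive.eventually (lt_mem_nhds (lt_top_iff_ne_top.2 hJ0f))
    rw [Filter.eventually_comap, Filter.eventually_atTop] at h1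
    obtain ⟨A, hA⟩ := h1
    exact ⟨A, fun z hz => hA ‖z‖ hz z rfl⟩
  let Φ : ℝ × Zs Kc × ℝ → ℝ≥0∞ := fun p =>
    E (zmap M Kc p.2.2 (p.1 • p.2.1)) + ENNReal.ofReal (lam * p.1)
  have hΦ : LowerSemicontinuous Φ := by
    apply LowerSemicontinuous.add
    · apply hE.lsc.comp
      have : Continuous fun p : ℝ × Zs Kc × ℝ => (p.2.2, p.1 • p.2.1) := by fun_prop
      exact (zmap_cont M Kc).comp this
    · apply Continuous.lowerSemicontinuous
      exact ENNReal.continuous_ofReal.comp (by fun_prop)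
  set R := J0.toReal / lam with hR
  let D : Set (ℝ × Zs Kc × ℝ) :=
    (Set.Icc 0 R ×ˢ (Kb Kc ×ˢ Set.Icc (-A) A)) ∩ {p | p.1 * p.2.1.1 = 0}
  have hD : IsCompact D := by
    apply (isCompact_Icc.prod ((Kb_compact Kc).prod isCompact_Icc)).inter_right
    exact isClosed_eq (by fun_prop) continuous_const
  have hmemD : ∀ (w : SignedMeasure Circle2pi) (a : ℝ), w Set.univ = 0 →
      penJ M E lam w a ≤ J0 → ∃ p ∈ D, Φ p = penJ M E lam w a := by
    intro w a hw hle
    obtain ⟨k, hk, hmk⟩ := mom_mem Kc w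
    refine ⟨(tvNorm w, k, a), ⟨⟨⟨tv_nonneg w, ?_⟩, hk, ?_⟩, ?_⟩, ?_⟩
    · have h1 : ENNReal.ofReal (lam * tvNorm w) ≤ J0 := le_trans le_add_self hle
      rw [ENNReal.ofReal_le_iff_le_toReal hJ0f] at h1
      change tvNorm w ≤ R
      rw [hR, le_div_iff₀ hlam]
      linarith
    · have h1 : E (nuMap M Kc w a) ≤ J0 := le_trans le_self_add hle
      have h2 : ‖nuMap M Kc w a‖ < A := by
        by_contra h
        exact absurd h1 (not_le.2 (hA _ (not_lt.1 h)))
      have h3 : ‖a‖ ≤ ‖nuMap M Kc w a‖ := norm_fst_le (nuMap M Kc w a)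
      rw [Real.norm_eq_abs] at h3
      have := abs_le.1 (h3.trans h2.le)
      exact ⟨this.1, this.2⟩
    · change tvNorm w * k.1 = 0
      rw [← hw, ← mom_fst Kc w, hmk]
      simp
    · change E (zmap M Kc a (tvNorm w • k)) + ENNReal.ofReal (lam * tvNorm w) = _
      rw [← hmk, ← nuMap_eq]
      rfl
  obtain ⟨p0, hp0, hp0v⟩ := hmemD w0 z0.1 hw0z le_rfl
  obtain ⟨p, hp, hmin⟩ := LowerSemicontinuousOn.exists_isMinOn ⟨p0, hp0⟩ hD
    (hΦ.lowerSemicontinuousOn D)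
  obtain ⟨⟨hr, hk, ha⟩, hz⟩ := hp
  obtain ⟨w, hw, htv⟩ := Kb_real_smul hk hr.1
  have hle : penJ M E lam w p.2.2 ≤ Φ p := by
    unfold penJ
    rw [nuMap_eq, hw]
    change _ ≤ E (zmap M Kc p.2.2 (p.1 • p.2.1)) + ENNReal.ofReal (lam * p.1)
    gcongr
  have hle0 : Φ p ≤ J0 := (hmin hp0).trans hp0v.le
  refine ⟨w, p.2.2, ?_, ?_, ?_⟩
  · rw [← mom_fst Kc, hw]
    exact hz
  · exact ne_top_of_le_ne_top hJ0f (hle.trans hle0)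
  · intro w' a' hw'
    rcases le_total (penJ M E lam w' a') J0 with h | h
    · obtain ⟨p', hp', hv⟩ := hmemD w' a' hw' h
      exact hle.trans ((hmin hp').trans hv.le)
    · exact hle.trans (hle0.trans h)

theorem min_unique_mom {M Kc : ℕ} {lam : ℝ} (hlam : 0 < lam)
    {E : ℝ × (Fin Kc → ℂ) → ℝ≥0∞} (hE : Admissible E)
    (w w' : SignedMeasure Circle2pi) (a a' : ℝ) (hw : w Set.univ = 0) (hw' : w' Set.univ = 0)
    (hf : penJ M E lam w a ≠ ∞)
    (hm : ∀ (v : SignedMeasure Circle2pi) (b : ℝ), v Set.univ = 0 →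
        penJ M E lam w a ≤ penJ M E lam v b)
    (hm' : ∀ (v : SignedMeasure Circle2pi) (b : ℝ), v Set.univ = 0 →
        penJ M E lam w' a' ≤ penJ M E lam v b) :
    a' = a ∧ mom Kc w' = mom Kc w ∧ tvNorm w' = tvNorm w := by
  have hJ : penJ M E lam w' a' = penJ M E lam w a := le_antisymm (hm' w a hw) (hm w' a' hw')
  have hEf : E (nuMap M Kc w a) ≠ ∞ := (ENNReal.add_ne_top.1 hf).1
  have hEf' : E (nuMap M Kc w' a') ≠ ∞ := by
    rw [← hJ] at hf
    exact (ENNReal.add_ne_top.1 hf).1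
  have hnu : nuMap M Kc w a = nuMap M Kc w' a' := by
    by_contra hne
    have hs := hE.strictConvexOnDom _ _ hEf hEf' hne (1/2) (by norm_num) (by norm_num)
    set v : SignedMeasure Circle2pi := (1/2 : ℝ) • w + (1 - 1/2 : ℝ) • w' with hv
    have hv0 : v Set.univ = 0 := by
      rw [← mom_fst Kc, hv, map_add, map_smul, map_smul]
      simp [mom_fst, hw, hw']
    have hvn : nuMap M Kc v ((1/2 : ℝ) * a + (1 - 1/2 : ℝ) * a') =
        (1/2 : ℝ) • nuMap M Kc w a + (1 - 1/2 : ℝ) • nuMap M Kc w' a' := by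
      rw [nuMap_eq, nuMap_eq, nuMap_eq, hv, map_add, map_smul, map_smul]
      refine Prod.ext rfl (funext fun k => ?_)
      simp [zmap]
      ring
    have htv : tvNorm v ≤ (1/2 : ℝ) * tvNorm w + (1 - 1/2 : ℝ) * tvNorm w' := by
      refine (tv_add _ _).trans ?_
      rw [tv_smul, tv_smul, abs_of_nonneg (by norm_num), abs_of_nonneg (by norm_num)]
    have h1 := hm v ((1/2 : ℝ) * a + (1 - 1/2 : ℝ) * a') hv0
    have h2 : penJ M E lam v ((1/2 : ℝ) * a + (1 - 1/2 : ℝ) * a') <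
        ENNReal.ofReal (1/2) * penJ M E lam w a +
          ENNReal.ofReal (1 - 1/2) * penJ M E lam w' a' := by
      have h3 : ENNReal.ofReal (lam * tvNorm v) ≤
          ENNReal.ofReal (1/2) * ENNReal.ofReal (lam * tvNorm w) +
            ENNReal.ofReal (1 - 1/2) * ENNReal.ofReal (lam * tvNorm w') := by
        have := tv_nonneg w
        have := tv_nonneg w'
        rw [← ENNReal.ofReal_mul (by norm_num), ← ENNReal.ofReal_mul (by norm_num),
          ← ENNReal.ofReal_add (by positivity) (by apply mul_nonneg <;> first | positivity | norm_num)]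
        apply ENNReal.ofReal_le_ofReal
        nlinarith
      unfold penJ
      rw [hvn]
      calc _ < (ENNReal.ofReal (1/2) * E (nuMap M Kc w a) +
            ENNReal.ofReal (1 - 1/2) * E (nuMap M Kc w' a')) + ENNReal.ofReal (lam * tvNorm v) :=
            ENNReal.add_lt_add_right ENNReal.ofReal_ne_top hs
        _ ≤ (ENNReal.ofReal (1/2) * E (nuMap M Kc w a) +
            ENNReal.ofReal (1 - 1/2) * E (nuMap M Kc w' a')) +
            (ENNReal.ofReal (1/2) * ENNReal.ofReal (lam * tvNorm w) +
            ENNReal.ofReal (1 - 1/2) * ENNReal.ofReal (lam * tvNorm w')) := by gcongr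
        _ = _ := by ring
    rw [hJ, ← add_mul, ← ENNReal.ofReal_add (by norm_num) (by norm_num)] at h2
    norm_num at h2
    norm_num at h1
    exact absurd h2 (not_lt.2 h1)
  have ha : a' = a := (congrArg Prod.fst hnu).symm
  refine ⟨ha, ?_, ?_⟩
  · refine Prod.ext ?_ (funext fun k => ?_)
    · rw [mom_fst, mom_fst, hw, hw']
    · have := congrFun (congrArg Prod.snd hnu) k
      rw [nuMap_eq, nuMap_eq] at this
      simp only [zmap] at this
      exact ((div_left_inj' (den_ne M k.1)).1 this).symm
  · unfold penJ at hJ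
    rw [hnu] at hJ
    have h1 := (ENNReal.add_right_inj hEf').1 hJ
    have := tv_nonneg w
    have := tv_nonneg w'
    rw [ENNReal.ofReal_eq_ofReal_iff (by positivity) (by positivity)] at h1
    exact mul_left_cancel₀ hlam.ne' h1

theorem min_struct {M Kc : ℕ} {lam : ℝ} (hlam : 0 < lam)
    {E : ℝ × (Fin Kc → ℂ) → ℝ≥0∞}
    (w : SignedMeasure Circle2pi) (a : ℝ) (hw : w Set.univ = 0)
    (hf : penJ M E lam w a ≠ ∞)
    (hm : ∀ (v : SignedMeasure Circle2pi) (b : ℝ), v Set.univ = 0 →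
        penJ M E lam w a ≤ penJ M E lam v b) :
    ∃ S : Finset Circle2pi, S.card ≤ 2 * Kc ∧ ∀ v : SignedMeasure Circle2pi,
      mom Kc v = mom Kc w → tvNorm v = tvNorm w → v = ∑ x ∈ S, v {x} • diracSM x := by
  rcases (tv_nonneg w).eq_or_lt with h0 | hpos
  · refine ⟨∅, by simp, fun v _ hv => ?_⟩
    rw [← h0] at hv
    simp [tv_eq_zero hv]
  have hmin : ∀ v, mom Kc v = mom Kc w → tvNorm w ≤ tvNorm v := by
    intro v hv
    have hv0 : v Set.univ = 0 := by rw [← mom_fst Kc, hv, mom_fst, hw]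
    have h1 := hm v a hv0
    unfold penJ at h1
    rw [nuMap_eq, nuMap_eq, hv] at h1
    have hEf : E (zmap M Kc a (mom Kc w)) ≠ ∞ := by
      rw [← nuMap_eq]; exact (ENNReal.add_ne_top.1 hf).1
    have h2 := (ENNReal.add_le_add_iff_left hEf).1 h1
    have := tv_nonneg v
    rw [ENNReal.ofReal_le_ofReal_iff (by positivity)] at h2
    exact le_of_mul_le_mul_left h2 hlam
  obtain ⟨l, hl, hlc⟩ := cert (mom Kc w) (tvNorm w) hpos hmin
  have hnc : ∃ v, l (0, v) ≠ 0 := by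
    by_contra hcon
    push Not at hcon
    have h1 : mom Kc w = (0, (mom Kc w).2) := Prod.ext (by rw [mom_fst, hw]) rfl
    rw [h1, hcon] at hlc
    linarith
  obtain ⟨u, hu⟩ := hnc
  obtain ⟨hfin, hcard⟩ := trig_ext l hl u hu
  refine ⟨hfin.toFinset, ?_, fun v hv htv => ?_⟩
  · rw [← Set.ncard_eq_toFinset_card _ hfin]
    exact hcard
  · obtain ⟨h1, h2⟩ := supp_cert l hl v (by rw [hv, htv]; exact hlc)
    apply sm_discrete
    · filter_upwards [h1] with x hx
      simpa using hx
    · filter_upwards [h2] with x hx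
      simpa using hx
/-- The TV-regularized recovery problem
`min_{(w,a)} E(ν(w,a)) + λ‖w‖_M` (over zero-mean signed measures `w` and means `a ∈ ℝ`)
has a unique minimizer `(w*, a*)`, and `w*` is a sum of at most `2·Kc` Dirac measures at
pairwise distinct points, with nonzero amplitudes summing to zero. -/
theorem stmt0 (M Kc : ℕ) (hM : 1 ≤ M) (lam : ℝ) (hlam : 0 < lam)
    (E : ℝ × (Fin Kc → ℂ) → ℝ≥0∞) (hE : Admissible E) :
    ∃ (wstar : SignedMeasure Circle2pi) (astar : ℝ),
      wstar Set.univ = 0 ∧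
      (∀ (w : SignedMeasure Circle2pi) (a : ℝ), w Set.univ = 0 →
        penJ M E lam wstar astar ≤ penJ M E lam w a) ∧
      (∀ (w : SignedMeasure Circle2pi) (a : ℝ), w Set.univ = 0 →
        (∀ (w' : SignedMeasure Circle2pi) (a' : ℝ), w' Set.univ = 0 →
          penJ M E lam w a ≤ penJ M E lam w' a') →
        w = wstar ∧ a = astar) ∧
      ∃ N : ℕ, N ≤ 2 * Kc ∧
        ∃ (x : Fin N → Circle2pi) (amp : Fin N → ℝ),
          Function.Injective x ∧ (∀ n, amp n ≠ 0) ∧ (∑ n, amp n) = 0 ∧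
            wstar = ∑ n, amp n • diracSM (x n) := by
  classical
  obtain ⟨w, a, hw, hf, hm⟩ := exists_min (M := M) hlam hE
  obtain ⟨S, hS, hrep⟩ := min_struct hlam w a hw hf hm
  have hwr := hrep w rfl rfl
  refine ⟨w, a, hw, hm, ?_, ?_⟩
  · intro w' a' hw' hm'
    obtain ⟨h1, h2, h3⟩ := min_unique_mom hlam hE w w' a a' hw hw' hf hm hm'
    have hwr' := hrep w' h2 h3
    refine ⟨?_, h1⟩
    have key := discrete_unique (Kc := Kc) S (by omega) (fun x => w' {x}) (fun x => w {x})
      (by rw [← hwr, ← hwr']; exact h2)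
    rw [hwr, hwr']
    exact Finset.sum_congr rfl fun x hx => by rw [key x hx]
  · set T := S.filter (fun x => w {x} ≠ 0) with hT
    have hwT : w = ∑ x ∈ T, w {x} • diracSM x := by
      conv_lhs => rw [hwr]
      symm
      apply Finset.sum_subset (Finset.filter_subset _ _)
      intro x hx hxT
      have : w {x} = 0 := by
        by_contra h
        exact hxT (Finset.mem_filter.2 ⟨hx, h⟩)
      rw [this, zero_smul]
    let e := T.equivFin
    have hsum : ∀ {V : Type} [AddCommMonoid V] (g : Circle2pi → V),
        ∑ n, g (e.symm n : Circle2pi) = ∑ x ∈ T, g x := by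
      intro V _ g
      rw [Equiv.sum_comp e.symm (fun x : T => g x), Finset.sum_coe_sort]
    refine ⟨T.card, (Finset.card_filter_le _ _).trans hS, fun n => (e.symm n : Circle2pi),
      fun n => w {(e.symm n : Circle2pi)}, ?_, ?_, ?_, ?_⟩
    · exact Subtype.val_injective.comp e.symm.injective
    · intro n
      exact (Finset.mem_filter.1 (e.symm n).2).2
    · rw [hsum (fun x => w {x})]
      have h1 : (mom Kc w).1 = ∑ x ∈ T, w {x} := by
        conv_lhs => rw [hwT]
        simp [mom_dirac, Prod.fst_sum, mcurve]
      rw [← h1, mom_fst, hw]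
    · rw [hsum (fun x => w {x} • diracSM x)]
      exact hwT
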